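/- Let k be a field of characteristic zero, ℓ ≥ 1, and let λ be an integer with 1 ≤ λ ≤ ℓ. Let p ∈ k[z_1,…,z_ℓ] be a polynomial involving only the variables z_1,…,z_λ that is symmetric in z_1,…,z_λ, and suppose that every monomial appearing in p has total degree at least r, where r ≥ 1. Then p^d ∈ I_S for every positive integer d with d·r > λ(ℓ−λ). -/

import Mathlib

open MvPolynomial

/-- A sum of `n` distinct natural numbers below `n + c` is at most `c + (c + 1) + ⋯`. -/
theorem sum_le_of_injective_of_lt {n c : ℕ} {s : Fin n → ℕ} (hs : Function.Injective s)
    (hlt : ∀ i, s i < n + c) : ∑ i, s i ≤ n * c + ∑ i : Fin n, (i : ℕ) := by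
  have hinj : Function.Injective fun i => -(s i : ℤ) := fun i j h => hs (by simpa using h)
  have key := Finset.sum_range_le_sum (s := Finset.univ.image fun i => -(s i : ℤ))
    (c := 1 - n - c) (by
      intro x hx
      obtain ⟨i, -, rfl⟩ := Finset.mem_image.mp hx
      have := hlt i
      lia)
  rw [Finset.sum_image hinj.injOn, Finset.card_image_of_injective _ hinj, Finset.card_univ,
    Fintype.card_fin, Finset.sum_add_distrib, Finset.sum_neg_distrib] at key
  simp only [Finset.sum_const, Finset.card_range, nsmul_eq_mul] at key
  have hgauss (N : ℕ) : (∑ i ∈ Finset.range N, (i : ℤ)) * 2 = N * (N - 1) := by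
    induction N with
    | zero => simp
    | succ N ih =>
      rw [Finset.sum_range_succ, add_mul, ih]
      push_cast
      ring
  have hfin : ((∑ i : Fin n, (i : ℕ) : ℕ) : ℤ) = ∑ i ∈ Finset.range n, (i : ℤ) := by
    rw [Fin.sum_univ_eq_sum_range (fun i => i)]
    push_cast
    rfl
  zify at hfin ⊢
  nlinarith [hgauss n]

namespace MvPolynomial

/-- The ideal generated by the symmetric polynomials without constant term. -/
noncomputable abbrev symmetricIdeal (τ k : Type*) [CommRing k] : Ideal (MvPolynomial τ k) :=
  Ideal.span {q : MvPolynomial τ k | q.IsSymmetric ∧ constantCoeff q = 0}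

theorem X_pow_card_mem_symmetricIdeal {τ k : Type*} [Fintype τ] [CommRing k] (i : τ) :
    (X i : MvPolynomial τ k) ^ Fintype.card τ ∈ symmetricIdeal τ k := by
  have h := congrArg (Polynomial.eval (-X i : MvPolynomial τ k))
    (prod_C_add_X_eq_sum_esymm k τ)
  rw [Polynomial.eval_prod, Finset.prod_eq_zero (Finset.mem_univ i) (by simp),
    Finset.sum_range_succ', Polynomial.eval_add, Polynomial.eval_finsetSum] at h
  have hmem : (-X i : MvPolynomial τ k) ^ Fintype.card τ ∈ symmetricIdeal τ k := by
    have h' : (-X i : MvPolynomial τ k) ^ Fintype.card τ =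
        -∑ j ∈ Finset.range (Fintype.card τ),
          esymm τ k (j + 1) * (-X i) ^ (Fintype.card τ - (j + 1)) := by
      rw [eq_neg_iff_add_eq_zero, add_comm]
      simpa using h.symm
    rw [h']
    refine neg_mem (sum_mem fun j _ => Ideal.mul_mem_right _ _ (Ideal.subset_span ⟨?_, ?_⟩))
    · exact esymm_isSymmetric _ _ _
    · rw [esymm, map_sum]
      refine Finset.sum_eq_zero fun t ht => ?_
      have hne : t.Nonempty := by
        rw [← Finset.card_pos, (Finset.mem_powersetCard.mp ht).2]
        lia
      obtain ⟨a, ha⟩ := hne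
      rw [map_prod]
      exact Finset.prod_eq_zero ha (by simp)
  rw [neg_pow] at hmem
  have := Ideal.mul_mem_left _ ((-1) ^ Fintype.card τ) hmem
  rwa [← mul_assoc, ← mul_pow, neg_one_mul, neg_neg, one_pow, one_mul] at this

theorem rename_mem_symmetricIdeal {τ υ k : Type*} [CommRing k] (e : τ ≃ υ)
    {f : MvPolynomial τ k} (hf : f ∈ symmetricIdeal τ k) :
    rename e f ∈ symmetricIdeal υ k := by
  have hle : symmetricIdeal τ k ≤ (symmetricIdeal υ k).comap (rename (R := k) e) := by
    refine Ideal.span_le.mpr fun q hq => Ideal.subset_span ⟨hq.1.rename e, ?_⟩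
    rw [constantCoeff_rename]
    exact hq.2
  exact hle hf

theorem irreducible_X_sub_X {τ k : Type*} [Field k] {i j : τ} (hij : i ≠ j) :
    Irreducible (X i - X j : MvPolynomial τ k) := by
  classical
  have hc : coeff (Finsupp.single i 1) (X i - X j : MvPolynomial τ k) = 1 := by
    simp [coeff_X, Finsupp.single_left_inj, hij.symm]
  refine irreducible_of_totalDegree_eq_one (le_antisymm ?_ ?_) fun x hx => ?_
  · refine (totalDegree_sub _ _).trans ?_
    simp
  · have hmem : Finsupp.single i 1 ∈ (X i - X j : MvPolynomial τ k).support := by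
      rw [mem_support_iff, hc]
      exact one_ne_zero
    simpa using le_totalDegree hmem
  · exact isUnit_of_dvd_one (hc ▸ hx (Finsupp.single i 1))

theorem not_X_sub_X_dvd_X_sub_X {τ k : Type*} [Field k] {i j a b : τ} (hab : a ≠ b)
    (h : a ≠ i ∧ a ≠ j ∨ b ≠ i ∧ b ≠ j) :
    ¬ (X i - X j : MvPolynomial τ k) ∣ X a - X b := by
  classical
  rintro ⟨g, hg⟩
  rcases h with ⟨h₁, h₂⟩ | ⟨h₁, h₂⟩
  · have := congrArg (eval (Pi.single a (1 : k))) hg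
    simp [h₁.symm, h₂.symm, hab.symm] at this
  · have := congrArg (eval (Pi.single b (1 : k))) hg
    simp [h₁.symm, h₂.symm, hab] at this

section Antisymmetrize

variable {n : ℕ} {β k : Type*} [Field k]

/-- The signed sum of the images of a polynomial under all permutations of the variables
indexed by `Fin n`. -/
noncomputable def antisymmetrize (n : ℕ) (β k : Type*) [Field k] :
    MvPolynomial (Fin n ⊕ β) k →ₗ[k] MvPolynomial (Fin n ⊕ β) k :=
  ∑ σ : Equiv.Perm (Fin n),
    (Equiv.Perm.sign σ : ℤ) • (rename (R := k) (Equiv.sumCongr σ (Equiv.refl β))).toLinearMap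

theorem antisymmetrize_apply (g : MvPolynomial (Fin n ⊕ β) k) :
    antisymmetrize n β k g = ∑ σ : Equiv.Perm (Fin n),
      (Equiv.Perm.sign σ : ℤ) • rename (Equiv.sumCongr σ (Equiv.refl β)) g := by
  simp [antisymmetrize, LinearMap.sum_apply]

theorem antisymmetrize_mul_of_invariant {f : MvPolynomial (Fin n ⊕ β) k}
    (hf : ∀ σ : Equiv.Perm (Fin n), rename (Equiv.sumCongr σ (Equiv.refl β)) f = f)
    (g : MvPolynomial (Fin n ⊕ β) k) :
    antisymmetrize n β k (g * f) = antisymmetrize n β k g * f := by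
  simp only [antisymmetrize_apply, map_mul, hf, Finset.sum_mul, smul_mul_assoc]

theorem antisymmetrize_rename_swap {i j : Fin n} (hij : i ≠ j)
    (g : MvPolynomial (Fin n ⊕ β) k) :
    antisymmetrize n β k (rename (Equiv.sumCongr (Equiv.swap i j) (Equiv.refl β)) g) =
      -antisymmetrize n β k g := by
  rw [antisymmetrize_apply, antisymmetrize_apply, ← Finset.sum_neg_distrib]
  refine Fintype.sum_equiv (Equiv.mulRight (Equiv.swap i j)) _ _ fun σ => ?_
  rw [rename_rename, Equiv.coe_mulRight, Equiv.Perm.sign_mul, Equiv.Perm.sign_swap hij]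
  have : (Equiv.sumCongr (σ * Equiv.swap i j) (Equiv.refl β) : Fin n ⊕ β → Fin n ⊕ β) =
      Equiv.sumCongr σ (Equiv.refl β) ∘ Equiv.sumCongr (Equiv.swap i j) (Equiv.refl β) := by
    ext x
    rcases x with x | x <;> simp
  rw [this]
  simp

theorem rename_swap_antisymmetrize {i j : Fin n} (hij : i ≠ j)
    (g : MvPolynomial (Fin n ⊕ β) k) :
    rename (Equiv.sumCongr (Equiv.swap i j) (Equiv.refl β)) (antisymmetrize n β k g) =
      -antisymmetrize n β k g := by
  rw [antisymmetrize_apply, map_sum, ← Finset.sum_neg_distrib]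
  refine Fintype.sum_equiv (Equiv.mulLeft (Equiv.swap i j)) _ _ fun σ => ?_
  rw [map_zsmul, rename_rename, Equiv.coe_mulLeft, Equiv.Perm.sign_mul,
    Equiv.Perm.sign_swap hij]
  have : (Equiv.sumCongr (Equiv.swap i j * σ) (Equiv.refl β) : Fin n ⊕ β → Fin n ⊕ β) =
      Equiv.sumCongr (Equiv.swap i j) (Equiv.refl β) ∘ Equiv.sumCongr σ (Equiv.refl β) := by
    ext x
    rcases x with x | x <;> simp
  rw [this]
  simp

theorem X_sub_X_dvd_antisymmetrize [CharZero k] {i j : Fin n} (hij : i ≠ j)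
    (g : MvPolynomial (Fin n ⊕ β) k) :
    (X (Sum.inl j) - X (Sum.inl i)) ∣ antisymmetrize n β k g := by
  set I : Ideal (MvPolynomial (Fin n ⊕ β) k) := Ideal.span {X (Sum.inl j) - X (Sum.inl i)}
  have hX : Ideal.Quotient.mkₐ k I (X (Sum.inl j)) = Ideal.Quotient.mkₐ k I (X (Sum.inl i)) :=
    Ideal.Quotient.eq.mpr (Ideal.mem_span_singleton_self _)
  have hswap : (Ideal.Quotient.mkₐ k I).comp
      (rename (Equiv.sumCongr (Equiv.swap i j) (Equiv.refl β))) = Ideal.Quotient.mkₐ k I := by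
    ext x
    rcases x with x | x
    · rcases eq_or_ne x i with rfl | hi
      · simpa using hX
      · rcases eq_or_ne x j with rfl | hj
        · simpa using hX.symm
        · simp [Equiv.swap_apply_of_ne_of_ne hi hj]
    · simp
  have h := DFunLike.congr_fun hswap (antisymmetrize n β k g)
  rw [AlgHom.comp_apply, rename_swap_antisymmetrize hij, ← sub_eq_zero, ← map_sub] at h
  have h2 : -antisymmetrize n β k g - antisymmetrize n β k g ∈ I :=
    Ideal.Quotient.eq_zero_iff_mem.mp h
  have h3 := Ideal.mul_mem_left I (C (-(2 : k)⁻¹)) h2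
  have h4 : C (-(2 : k)⁻¹) * (-antisymmetrize n β k g - antisymmetrize n β k g) =
      antisymmetrize n β k g := by
    have : (C ((2 : k)⁻¹) * 2 : MvPolynomial (Fin n ⊕ β) k) = 1 := by
      rw [← map_ofNat (C : k →+* MvPolynomial (Fin n ⊕ β) k) 2, ← map_mul,
        inv_mul_cancel₀ two_ne_zero, map_one]
    rw [map_neg]
    linear_combination antisymmetrize n β k g * this
  rw [h4] at h3
  exact Ideal.mem_span_singleton.mp h3

/-- The Vandermonde determinant in the variables indexed by `Fin n`. -/
noncomputable abbrev vandermondeDet (n : ℕ) (β k : Type*) [Field k] :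
    MvPolynomial (Fin n ⊕ β) k :=
  (Matrix.vandermonde fun i : Fin n => (X (Sum.inl i) : MvPolynomial (Fin n ⊕ β) k)).det

theorem vandermondeDet_dvd_antisymmetrize [CharZero k] (g : MvPolynomial (Fin n ⊕ β) k) :
    vandermondeDet n β k ∣ antisymmetrize n β k g := by
  rw [vandermondeDet, Matrix.det_vandermonde, Finset.prod_sigma']
  refine Finset.prod_dvd_of_isRelPrime ?_ ?_
  · rintro ⟨i, j⟩ hij ⟨a, b⟩ hab hne
    simp only [Finset.coe_sigma, Set.mem_sigma_iff, Finset.coe_univ, Set.mem_univ,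
      Finset.coe_Ioi, Set.mem_Ioi, true_and] at hij hab
    have hij' : (Sum.inl j : Fin n ⊕ β) ≠ Sum.inl i := by simpa using hij.ne'
    have hab' : (Sum.inl b : Fin n ⊕ β) ≠ Sum.inl a := by simpa using hab.ne'
    refine (irreducible_X_sub_X hij').isRelPrime_iff_not_dvd.mpr
      (not_X_sub_X_dvd_X_sub_X hab' ?_)
    have hne' : ¬ (i = a ∧ j = b) := by
      rintro ⟨rfl, rfl⟩
      exact hne rfl
    simp only [ne_eq, Sum.inl.injEq]
    lia
  · rintro ⟨i, j⟩ hij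
    simp only [Finset.mem_sigma, Finset.mem_univ, Finset.mem_Ioi, true_and] at hij
    exact X_sub_X_dvd_antisymmetrize hij.ne g

theorem antisymmetrize_prod_X_pow :
    antisymmetrize n β k (∏ i : Fin n, X (Sum.inl i) ^ (i : ℕ)) = vandermondeDet n β k := by
  rw [antisymmetrize_apply, vandermondeDet, Matrix.det_apply]
  refine Finset.sum_congr rfl fun σ _ => ?_
  simp [map_prod, Matrix.vandermonde_apply, Units.smul_def]

theorem antisymmetrize_eq_zero_of_rename_swap [CharZero k] {i j : Fin n} (hij : i ≠ j)
    {g : MvPolynomial (Fin n ⊕ β) k}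
    (hg : rename (Equiv.sumCongr (Equiv.swap i j) (Equiv.refl β)) g = g) :
    antisymmetrize n β k g = 0 := by
  have h := antisymmetrize_rename_swap hij g
  rw [hg] at h
  exact self_eq_neg.mp h

theorem antisymmetrize_mem_of_mem_symmetricIdeal [CharZero k]
    {g : MvPolynomial (Fin n ⊕ β) k} (hg : g ∈ symmetricIdeal (Fin n ⊕ β) k) :
    antisymmetrize n β k g ∈
      Ideal.span {vandermondeDet n β k} * symmetricIdeal (Fin n ⊕ β) k := by
  rw [← one_mul g]
  generalize (1 : MvPolynomial (Fin n ⊕ β) k) = h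
  induction hg using Submodule.span_induction generalizing h with
  | mem x hx =>
    rw [antisymmetrize_mul_of_invariant fun σ => hx.1 _]
    exact Ideal.mul_mem_mul
      (Ideal.mem_span_singleton.mpr (vandermondeDet_dvd_antisymmetrize h)) (Ideal.subset_span hx)
  | zero => simp
  | add x y _ _ hx hy =>
    rw [mul_add, map_add]
    exact add_mem (hx h) (hy h)
  | smul a x _ hx =>
    rw [smul_eq_mul, ← mul_assoc]
    exact hx (h * a)

theorem antisymmetrize_prod_X_pow_mem [CharZero k] [Fintype β] {s : Fin n → ℕ}
    (hs : n * Fintype.card β + ∑ i : Fin n, (i : ℕ) < ∑ i, s i) :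
    antisymmetrize n β k (∏ i, X (Sum.inl i) ^ s i) ∈
      Ideal.span {vandermondeDet n β k} * symmetricIdeal (Fin n ⊕ β) k := by
  by_cases hinj : Function.Injective s
  · obtain ⟨i, hi⟩ : ∃ i, n + Fintype.card β ≤ s i := by
      by_contra! hlt
      exact hs.not_ge (sum_le_of_injective_of_lt hinj hlt)
    refine antisymmetrize_mem_of_mem_symmetricIdeal (Ideal.mem_of_dvd _
      ((pow_dvd_pow _ ?_).trans (Finset.dvd_prod_of_mem _ (Finset.mem_univ i)))
      (X_pow_card_mem_symmetricIdeal _))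
    simpa using hi
  · obtain ⟨i, j, hsij, hij⟩ : ∃ i j, s i = s j ∧ i ≠ j := by
      simpa [Function.Injective] using hinj
    rw [antisymmetrize_eq_zero_of_rename_swap hij]
    · exact zero_mem _
    · rw [map_prod]
      refine Fintype.prod_equiv (Equiv.swap i j) _ _ fun x => ?_
      have hsx : s (Equiv.swap i j x) = s x := by
        rcases eq_or_ne x i with rfl | hi
        · simp [hsij]
        · rcases eq_or_ne x j with rfl | hj
          · simp [hsij]
          · rw [Equiv.swap_apply_of_ne_of_ne hi hj]
      simp [hsx]

theorem rename_inl_mem_symmetricIdeal [CharZero k] [Fintype β] {f : MvPolynomial (Fin n) k}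
    (hf : f.IsSymmetric) (hdeg : ∀ m ∈ f.support, n * Fintype.card β < m.degree) :
    rename Sum.inl f ∈ symmetricIdeal (Fin n ⊕ β) k := by
  have hinv (σ : Equiv.Perm (Fin n)) :
      rename (Equiv.sumCongr σ (Equiv.refl β)) (rename Sum.inl f) = rename Sum.inl f := by
    conv_rhs => rw [← hf σ]
    rw [rename_rename, rename_rename]
    rfl
  have hmem : antisymmetrize n β k ((∏ i : Fin n, X (Sum.inl i) ^ (i : ℕ)) * rename Sum.inl f) ∈
      Ideal.span {vandermondeDet n β k} * symmetricIdeal (Fin n ⊕ β) k := by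
    conv in rename Sum.inl f => rw [f.as_sum]
    rw [map_sum, Finset.mul_sum, map_sum]
    refine sum_mem fun m hm => ?_
    have hmon : (∏ i : Fin n, X (Sum.inl i) ^ (i : ℕ)) *
        rename Sum.inl (monomial m (coeff m f)) =
        coeff m f • ∏ i : Fin n, (X (Sum.inl i) : MvPolynomial (Fin n ⊕ β) k) ^ (i + m i) := by
      rw [monomial_eq, Finsupp.prod_fintype _ _ (by simp), map_mul, rename_C, map_prod,
        smul_eq_C_mul, mul_left_comm, ← Finset.prod_mul_distrib]
      simp [pow_add]
    rw [hmon, map_smul, smul_eq_C_mul]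
    refine Ideal.mul_mem_left _ _ (antisymmetrize_prod_X_pow_mem ?_)
    have := hdeg m hm
    rw [Finsupp.degree_eq_sum] at this
    rw [Finset.sum_add_distrib]
    lia
  rw [antisymmetrize_mul_of_invariant hinv, antisymmetrize_prod_X_pow,
    Ideal.mem_span_singleton_mul] at hmem
  obtain ⟨z, hz, hzf⟩ := hmem
  have hne : vandermondeDet n β k ≠ 0 :=
    Matrix.det_vandermonde_ne_zero_iff.mpr fun i j h => Sum.inl_injective (X_injective h)
  exact mul_left_cancel₀ hne hzf ▸ hz

end Antisymmetrize

theorem le_degree_of_mem_support_pow {τ k : Type*} [CommRing k] {f : MvPolynomial τ k} {r : ℕ}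
    (hf : ∀ m ∈ f.support, r ≤ m.degree) (d : ℕ) :
    ∀ m ∈ (f ^ d).support, d * r ≤ m.degree := by
  classical
  induction d with
  | zero => simp
  | succ d ih =>
    intro m hm
    rw [pow_succ] at hm
    obtain ⟨a, ha, b, hb, rfl⟩ := Finset.mem_add.mp (support_mul _ _ hm)
    rw [map_add, add_mul, one_mul]
    exact add_le_add (ih a ha) (hf b hb)

end MvPolynomial

/-- Let `k` be a field of characteristic zero, `ℓ ≥ 1`, `1 ≤ λ ≤ ℓ`.
Let `p ∈ k[z_1,…,z_ℓ]` involve only the variables `z_1,…,z_λ`, be symmetric in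
`z_1,…,z_λ`, and suppose every monomial of `p` has total degree at least `r ≥ 1`.
Then `p^d ∈ I_S` for every positive integer `d` with `d·r > λ(ℓ-λ)`. -/
theorem pow_mem_symmetric_ideal_of_large_power
    (k : Type*) [Field k] [CharZero k] (ℓ lam r d : ℕ) (hℓ : 1 ≤ ℓ)
    (hlam₁ : 1 ≤ lam) (hlam₂ : lam ≤ ℓ)
    (p : MvPolynomial (Fin ℓ) k)
    (hvars : ∀ m ∈ p.support, ∀ i : Fin ℓ, lam ≤ (i : ℕ) → m i = 0)
    (hsym : ∀ σ : Equiv.Perm (Fin ℓ), (∀ i : Fin ℓ, lam ≤ (i : ℕ) → σ i = i) →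
      rename σ p = p)
    (hr : 1 ≤ r)
    (hdeg : ∀ m ∈ p.support, r ≤ m.sum fun _ e => e)
    (hd : 1 ≤ d) (hdr : lam * (ℓ - lam) < d * r) :
    p ^ d ∈ Ideal.span {q : MvPolynomial (Fin ℓ) k | q.IsSymmetric ∧ constantCoeff q = 0} := by
  obtain ⟨c, rfl⟩ := Nat.exists_eq_add_of_le hlam₂
  rw [Nat.add_sub_cancel_left] at hdr
  have hinj := Fin.castAdd_injective lam c
  obtain ⟨q, rfl⟩ := exists_rename_eq_of_vars_subset_range p (Fin.castAdd c) hinj (by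
    intro i hi
    obtain ⟨m, hm, him⟩ := (mem_vars_iff_mem_support i).mp hi
    by_contra hrange
    refine Finsupp.mem_support_iff.mp him (hvars m hm i ?_)
    by_contra! hlt
    exact hrange ⟨⟨i, hlt⟩, rfl⟩)
  have hq : q.IsSymmetric := by
    intro σ
    apply rename_injective _ hinj
    have h := hsym (finSumFinEquiv.permCongr (Equiv.sumCongr σ (Equiv.refl (Fin c)))) (by
      intro i hi
      induction i using Fin.addCases with
      | left i => exact absurd hi (not_le.mpr i.isLt)
      | right i => simp [Equiv.permCongr_apply])
    rw [rename_rename] at h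
    rw [rename_rename, ← h]
    congr 2
    ext i
    simp [Equiv.permCongr_apply]
  have hqdeg : ∀ m ∈ q.support, r ≤ m.degree := by
    intro m hm
    have h := hdeg (m.mapDomain (Fin.castAdd c)) (by
      rw [mem_support_iff, coeff_rename_mapDomain _ hinj]
      exact mem_support_iff.mp hm)
    rwa [Finsupp.sum_mapDomain_index (by simp) (by simp)] at h
  have hmem := rename_inl_mem_symmetricIdeal (β := Fin c) (f := q ^ d)
    (fun σ => by rw [map_pow, hq σ])
    (fun m hm => by
      rw [Fintype.card_fin]
      exact hdr.trans_le (le_degree_of_mem_support_pow hqdeg d m hm))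
  have h := rename_mem_symmetricIdeal finSumFinEquiv hmem
  rw [rename_rename] at h
  rw [← map_pow]
  exact h
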